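/- Let H be a real Hilbert space, let a < b be real numbers, and let f : ℝ → H be twice continuously differentiable on [a,b]. Then the backward difference quotient satisfies ‖ (f(b) − f(a))/(b − a) − f'(b) ‖² ≤ ((b − a)/3) · ∫_a^b ‖f''(s)‖² ds. -/

import Mathlib

open Set

/-- backward Euler consistency estimate in a Hilbert space:
`‖(f(b) − f(a))/(b − a) − f'(b)‖² ≤ ((b − a)/3) ∫_a^b ‖f''(s)‖² ds`. -/
theorem backward_euler_consistency_sq
    {H : Type*} [NormedAddCommGroup H] [InnerProductSpace ℝ H] [CompleteSpace H]
    (a b : ℝ) (hab : a < b)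
    (f f' f'' : ℝ → H)
    (hf : ∀ s ∈ Icc a b, HasDerivWithinAt f (f' s) (Icc a b) s)
    (hf' : ∀ s ∈ Icc a b, HasDerivWithinAt f' (f'' s) (Icc a b) s)
    (hf'' : ContinuousOn f'' (Icc a b)) :
    ‖(b - a)⁻¹ • (f b - f a) - f' b‖ ^ 2
      ≤ ((b - a) / 3) * ∫ s in a..b, ‖f'' s‖ ^ 2 := by
  have hh : 0 < b - a := sub_pos.2 hab
  set E : H := (b - a)⁻¹ • (f b - f a) - f' b with hE
  set c : ℝ := 3 / (b - a) ^ 2 with hc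
  -- The derivative of `ψ` is `‖f''‖ ^ 2 - ‖f'' + c (s - a) E‖ ^ 2`.
  let ψ : ℝ → ℝ := fun s =>
    2 * c * inner ℝ (f s - (s - a) • f' s) E - c ^ 2 * ‖E‖ ^ 2 * ((s - a) ^ 3 / 3)
  let ψ' : ℝ → ℝ := fun s =>
    2 * c * inner ℝ (-((s - a) • f'' s)) E - c ^ 2 * ‖E‖ ^ 2 * (s - a) ^ 2
  have hψ : ∀ s ∈ Icc a b, HasDerivWithinAt ψ (ψ' s) (Icc a b) s := by
    intro s hs
    have hlin : HasDerivWithinAt (fun s : ℝ => s - a) 1 (Icc a b) s :=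
      (hasDerivWithinAt_id s _).sub_const a
    have hg := ((hf s hs).fun_sub (hlin.fun_smul (hf' s hs))).inner ℝ
      (hasDerivWithinAt_const s (Icc a b) E)
    have hcube := (hlin.fun_pow 3).div_const 3
    refine ((hg.const_mul (2 * c)).fun_sub
      (hcube.const_mul (c ^ 2 * ‖E‖ ^ 2))).congr_deriv ?_
    simp only [ψ', one_smul, sub_add_cancel_right, inner_zero_right, zero_add]
    norm_num
  have hle : ∀ s, ψ' s ≤ ‖f'' s‖ ^ 2 := by
    intro s
    have h := norm_add_sq_real (f'' s) ((c * (s - a)) • E)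
    rw [norm_smul, mul_pow, Real.norm_eq_abs, sq_abs, real_inner_smul_right] at h
    simp only [ψ', inner_neg_left, real_inner_smul_left]
    nlinarith [sq_nonneg ‖f'' s + (c * (s - a)) • E‖]
  have hkey : ψ b - ψ a ≤ ∫ s in a..b, ‖f'' s‖ ^ 2 := by
    refine intervalIntegral.sub_le_integral_of_hasDeriv_right_of_le hab.le
      (fun s hs => (hψ s hs).continuousWithinAt)
      (fun s hs => ((hψ s (Ioo_subset_Icc_self hs)).hasDerivAt
        (Icc_mem_nhds hs.1 hs.2)).hasDerivWithinAt)
      ((hf''.norm.pow 2).integrableOn_Icc) (fun s _ => hle s)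
  have hdiff : f b - (b - a) • f' b - f a = (b - a) • E := by
    rw [hE, smul_sub, smul_inv_smul₀ hh.ne']
    abel
  have hval : ψ b - ψ a = 3 / (b - a) * ‖E‖ ^ 2 := by
    have hinner : inner ℝ (f b - (b - a) • f' b) E - inner ℝ (f a) E = (b - a) * ‖E‖ ^ 2 := by
      rw [← inner_sub_left, hdiff, real_inner_smul_left, real_inner_self_eq_norm_sq]
    have hsplit : ψ b - ψ a = 2 * c * (inner ℝ (f b - (b - a) • f' b) E - inner ℝ (f a) E)
        - c ^ 2 * ‖E‖ ^ 2 * ((b - a) ^ 3 / 3) := by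
      simp only [ψ, sub_self, zero_smul, sub_zero]
      ring
    rw [hsplit, hinner, hc]
    field_simp
    ring
  calc ‖E‖ ^ 2 = (b - a) / 3 * (3 / (b - a) * ‖E‖ ^ 2) := by field_simp
    _ ≤ (b - a) / 3 * ∫ s in a..b, ‖f'' s‖ ^ 2 := by
      rw [← hval]
      gcongr
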